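/- Define h_k(x) = (k−1+(k−1+x)²)·k!·f_k(x) − k·(k−1+x)·x^k for natural numbers k ≥ 1 and real x ≥ 0. Then h_1(x) = −x² e^{−x} for all x ≥ 0, h_k(0) = 0 for every k ≥ 2, and for every k ≥ 2 the derivative satisfies h_k'(x) = k·h_{k−1}(x) for all x ≥ 0. -/

import Mathlib

/-- The signed tail of the Taylor series of `e^{-x}`:
`f k x = (-1)^k ∑_{j=k}^∞ (-x)^j / j!`. -/
noncomputable def f (k : ℕ) (x : ℝ) : ℝ :=
  (-1 : ℝ) ^ k * ∑' j : ℕ, (-x) ^ (k + j) / (Nat.factorial (k + j))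

/-- `h k x = (k - 1 + (k - 1 + x)^2) k! f_k(x) - k (k - 1 + x) x^k`. -/
noncomputable def h (k : ℕ) (x : ℝ) : ℝ :=
  ((k : ℝ) - 1 + ((k : ℝ) - 1 + x) ^ 2) * (Nat.factorial k) * f k x -
    (k : ℝ) * ((k : ℝ) - 1 + x) * x ^ k

lemma f_zero_eq (x : ℝ) : f 0 x = Real.exp (-x) := by
  rw [Real.exp_eq_exp_ℝ, NormedSpace.exp_eq_tsum_div]
  simp [f]

lemma f_succ_eq (k : ℕ) (x : ℝ) : f (k + 1) x = x ^ k / (Nat.factorial k) - f k x := by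
  have hs : Summable (fun j : ℕ => (-x) ^ (k + j) / (Nat.factorial (k + j) : ℝ)) := by
    have := (summable_nat_add_iff k).2 (Real.summable_pow_div_factorial (-x))
    simpa [add_comm] using this
  have e := hs.tsum_eq_zero_add
  have e2 : ∀ j : ℕ, k + 1 + j = k + (j + 1) := fun j => by ring
  have e3 : (-1 : ℝ) ^ k * (-x) ^ k = x ^ k := by rw [← mul_pow]; simp
  unfold f
  simp only [e2]
  rw [e, ← e3, pow_succ]
  simp only [add_zero]
  ring

lemma f_deriv (k : ℕ) (x : ℝ) : HasDerivAt (f (k + 1)) (f k x) x := by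
  induction k with
  | zero =>
    have e : f (0 + 1) = fun x => 1 - Real.exp (-x) := by
      funext y
      rw [f_succ_eq, f_zero_eq]; simp
    rw [e, f_zero_eq]
    have := ((hasDerivAt_id x).neg.exp).const_sub 1
    simpa using this
  | succ k ih =>
    have e : f (k + 1 + 1) = fun x => x ^ (k + 1) / (Nat.factorial (k + 1)) - f (k + 1) x := by
      funext y
      rw [f_succ_eq]
    rw [e, f_succ_eq k x]
    have := ((hasDerivAt_pow (k + 1) x).div_const (Nat.factorial (k + 1) : ℝ)).sub ih
    refine this.congr_deriv ?_
    have h1 : (Nat.factorial k : ℝ) ≠ 0 := by positivity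
    have h2 : (k : ℝ) + 1 ≠ 0 := by positivity
    rw [Nat.factorial_succ]
    push_cast
    field_simp

theorem stmt_6 :
    (∀ x : ℝ, 0 ≤ x → h 1 x = -x ^ 2 * Real.exp (-x)) ∧
    (∀ k : ℕ, 2 ≤ k → h k 0 = 0) ∧
    (∀ k : ℕ, 2 ≤ k → ∀ x : ℝ, 0 ≤ x →
      HasDerivAt (h k) ((k : ℝ) * h (k - 1) x) x) := by
  refine ⟨fun x _ => ?_, fun k hk => ?_, fun k hk x _ => ?_⟩
  · have e : f 1 x = 1 - Real.exp (-x) := by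
      have := f_succ_eq 0 x
      rw [f_zero_eq] at this
      simpa using this
    simp [h, e]
    ring
  · have hf : f k 0 = 0 := by
      unfold f
      have : ∀ j : ℕ, (-(0:ℝ)) ^ (k + j) / (Nat.factorial (k + j) : ℝ) = 0 := fun j => by
        rw [neg_zero, zero_pow (by omega), zero_div]
      simp only [this, tsum_zero, mul_zero]
    unfold h
    rw [hf, zero_pow (by omega)]
    ring
  · obtain ⟨m, rfl⟩ : ∃ m, k = m + 1 := ⟨k - 1, by omega⟩
    have hy : HasDerivAt (fun y : ℝ => ((m + 1 : ℕ) : ℝ) - 1 + y) 1 x :=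
      (hasDerivAt_id x).const_add _
    have h1 := (((hy.pow 2).const_add (((m + 1 : ℕ) : ℝ) - 1)).mul_const
      (Nat.factorial (m + 1) : ℝ)).mul (f_deriv m x)
    have h2 := (hy.const_mul ((m + 1 : ℕ) : ℝ)).mul (hasDerivAt_pow (m + 1) x)
    refine (h1.sub h2).congr_deriv ?_
    have h3 : (Nat.factorial m : ℝ) ≠ 0 := by positivity
    simp only [h, Nat.add_sub_cancel, f_succ_eq m x, Nat.factorial_succ, Pi.pow_apply]
    push_cast
    field_simp
    ring
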